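/- arXiv:2401.03363 — 2 statements merged into one kernel-verified Lean document; each statement's English description precedes it below -/
import Mathlib

section
/- Let X₁ ∈ ℝ^{n×τ}, Y ∈ ℝ^{τ×n}, Δ ∈ ℝ^{n×n} be real matrices, γ > 0 a real number, and Ω ∈ ℝ^{n×n} a symmetric positive definite matrix. Suppose the (n+τ)×(n+τ) block matrix [[X₁·Y + (X₁·Y)ᵀ + Ω + γ·Δ·Δᵀ, Yᵀ],[Y, −γ·I]] is negative definite. Then for every D ∈ ℝ^{n×τ} with D·Dᵀ ⪯ Δ·Δᵀ (in the Loewner order), the matrix (X₁ − D)·Y + Yᵀ·(X₁ − D)ᵀ + Ω is negative definite. -/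
open scoped Matrix

/-- If the block matrix
`[[X₁Y + (X₁Y)ᵀ + Ω + γΔΔᵀ, Yᵀ], [Y, −γI]]` is negative definite (LMI (10) of the
paper), with `Ω` symmetric positive definite and `γ > 0`, then for every `D` with
`D·Dᵀ ⪯ Δ·Δᵀ` (Loewner order) the matrix `(X₁ − D)Y + Yᵀ(X₁ − D)ᵀ + Ω` is negative
definite (Lemma 2 of the paper). -/
theorem lmi_implies_robust_negdef
    {n τ : ℕ} (X₁ : Matrix (Fin n) (Fin τ) ℝ) (Y : Matrix (Fin τ) (Fin n) ℝ)
    (Δ Ω : Matrix (Fin n) (Fin n) ℝ) (γ : ℝ) (hγ : 0 < γ)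
    (hΩ : Ω.PosDef)
    (hLMI : (-(Matrix.fromBlocks (X₁ * Y + (X₁ * Y)ᵀ + Ω + γ • (Δ * Δᵀ)) Yᵀ Y
        (-(γ • (1 : Matrix (Fin τ) (Fin τ) ℝ))))).PosDef) :
    ∀ D : Matrix (Fin n) (Fin τ) ℝ, (Δ * Δᵀ - D * Dᵀ).PosSemidef →
      (-((X₁ - D) * Y + Yᵀ * (X₁ - D)ᵀ + Ω)).PosDef := by
  intro D hD
  -- Restrict the quadratic form of the LMI to the graph of `-Dᵀ`.
  have hinj : Function.Injective
      (Matrix.fromRows (1 : Matrix (Fin n) (Fin n) ℝ) (-Dᵀ)).mulVec := by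
    intro x y hxy
    simpa [Matrix.fromRows_mulVec] using
      congrArg (fun v => v ∘ Sum.inl) hxy
  have hgraph := hLMI.conjTranspose_mul_mul_same hinj
  convert hgraph.add_posSemidef (hD.smul hγ.le) using 1
  rw [Matrix.conjTranspose_eq_transpose_of_trivial, Matrix.transpose_fromRows,
    Matrix.fromBlocks_neg, Matrix.fromCols_mul_fromBlocks, Matrix.fromCols_mul_fromRows]
  simp only [Matrix.transpose_one, Matrix.transpose_neg, Matrix.transpose_transpose,
    Matrix.transpose_sub, Matrix.transpose_mul, Matrix.one_mul, Matrix.mul_one, Matrix.neg_mul,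
    Matrix.mul_neg, Matrix.sub_mul, Matrix.mul_sub, Matrix.add_mul, Matrix.smul_mul,
    Matrix.mul_smul, smul_sub, smul_neg, neg_neg]
  abel
end

section
/- Let n, m, τ be positive natural numbers, A ∈ ℝ^{n×n}, B ∈ ℝ^{n×m}, X₀, D₀, X₁ ∈ ℝ^{n×τ}, U₀ ∈ ℝ^{m×τ} real matrices with X₁ = A·X₀ + B·U₀ + D₀, let Δ ∈ ℝ^{n×n} with D₀·D₀ᵀ ⪯ Δ·Δᵀ, let Ω ∈ ℝ^{n×n} be symmetric positive definite, γ > 0, and Y ∈ ℝ^{τ×n}. Suppose the block matrix [[X₁·Y + (X₁·Y)ᵀ + Ω + γ·Δ·Δᵀ, Yᵀ],[Y, −γ·I]] is negative definite and X₀·Y is symmetric positive definite. Set P = (X₀·Y)⁻¹ and K = U₀·Y·(X₀·Y)⁻¹. Then P·(A + B·K) + (A + B·K)ᵀ·P + P·Ω·P is negative definite. -/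
open scoped Matrix

/-- Evaluating a negative definite block matrix on the graph `{(x, W x)}`. -/
theorem Matrix.PosDef.neg_add_of_neg_fromBlocks {ι κ : Type*} [Fintype ι] [Fintype κ]
    [DecidableEq ι] {M : Matrix ι ι ℝ} {Y : Matrix κ ι ℝ} {R : Matrix κ κ ℝ}
    (h : (-(Matrix.fromBlocks M Yᵀ Y R)).PosDef) (W : Matrix κ ι ℝ) :
    (-(M + Wᵀ * Y + Yᵀ * W + Wᵀ * R * W)).PosDef := by
  have hinj : Function.Injective (Matrix.fromRows (1 : Matrix ι ι ℝ) W).mulVec := by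
    intro x y hxy
    simp only [Matrix.fromRows_mulVec, Matrix.one_mulVec] at hxy
    exact funext fun i => congrFun hxy (Sum.inl i)
  convert h.conjTranspose_mul_mul_same hinj using 1
  rw [Matrix.conjTranspose_eq_transpose_of_trivial, Matrix.transpose_fromRows,
    Matrix.mul_neg, Matrix.neg_mul, Matrix.fromCols_mul_fromBlocks, Matrix.fromCols_mul_fromRows]
  simp only [Matrix.transpose_one, Matrix.one_mul, Matrix.mul_one, Matrix.add_mul]
  abel

/-- Under data consistency, the disturbance bound
`D₀·D₀ᵀ ⪯ Δ·Δᵀ`, and the data-driven LMIs (10)–(11) of the paper, the closed-loop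
matrix `P·(A+BK) + (A+BK)ᵀ·P + P·Ω·P` (with `P = (X₀Y)⁻¹` and
`K = U₀·Y·(X₀Y)⁻¹`) is negative definite. -/
theorem closed_loop_lyapunov_inequality
    {n m τ : ℕ} (hn : 0 < n) (hm : 0 < m) (hτ : 0 < τ)
    (A : Matrix (Fin n) (Fin n) ℝ) (B : Matrix (Fin n) (Fin m) ℝ)
    (X₀ D₀ X₁ : Matrix (Fin n) (Fin τ) ℝ) (U₀ : Matrix (Fin m) (Fin τ) ℝ)
    (Δ Ω : Matrix (Fin n) (Fin n) ℝ) (γ : ℝ) (Y : Matrix (Fin τ) (Fin n) ℝ)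
    (hdata : X₁ = A * X₀ + B * U₀ + D₀)
    (hD : (Δ * Δᵀ - D₀ * D₀ᵀ).PosSemidef)
    (hΩ : Ω.PosDef) (hγ : 0 < γ)
    (hLMI : (-(Matrix.fromBlocks (X₁ * Y + (X₁ * Y)ᵀ + Ω + γ • (Δ * Δᵀ)) Yᵀ Y
        (-(γ • (1 : Matrix (Fin τ) (Fin τ) ℝ))))).PosDef)
    (hXY : (X₀ * Y).PosDef)
    (P : Matrix (Fin n) (Fin n) ℝ) (K : Matrix (Fin m) (Fin n) ℝ)
    (hP : P = (X₀ * Y)⁻¹) (hK : K = U₀ * Y * (X₀ * Y)⁻¹) :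
    (-(P * (A + B * K) + (A + B * K)ᵀ * P + P * Ω * P)).PosDef := by
  have hdet : IsUnit (X₀ * Y).det := (Matrix.isUnit_iff_isUnit_det _).mp hXY.isUnit
  have hPdef : P.PosDef := hP ▸ hXY.inv
  have hPt : Pᵀ = P := by
    simpa only [Matrix.conjTranspose_eq_transpose_of_trivial] using hPdef.isHermitian.eq
  have hcancel : (A * X₀ + B * U₀) * Y * P = A + B * K := by
    rw [hK, hP, Matrix.add_mul, Matrix.add_mul, Matrix.mul_assoc A, Matrix.mul_assoc A,
      Matrix.mul_nonsing_inv _ hdet, Matrix.mul_one]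
    simp only [Matrix.mul_assoc]
  have hS : (-((A * X₀ + B * U₀) * Y + ((A * X₀ + B * U₀) * Y)ᵀ + Ω)).PosDef := by
    convert (hLMI.neg_add_of_neg_fromBlocks (-D₀ᵀ)).add_posSemidef (hD.smul hγ.le) using 1
    simp only [hdata, Matrix.transpose_neg, Matrix.transpose_transpose, Matrix.transpose_mul,
      Matrix.transpose_add, Matrix.add_mul, Matrix.neg_mul, Matrix.mul_neg,
      Matrix.mul_smul, Matrix.smul_mul, Matrix.mul_one, smul_sub, smul_neg,
      neg_neg]
    abel
  convert hS.conjTranspose_mul_mul_same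
    (Matrix.mulVec_injective_iff_isUnit.mpr hPdef.isUnit) using 1
  rw [Matrix.conjTranspose_eq_transpose_of_trivial, ← hcancel,
    Matrix.transpose_mul _ P, hPt]
  simp only [Matrix.mul_neg, Matrix.neg_mul, Matrix.mul_add,
    Matrix.add_mul, Matrix.mul_assoc]
end
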